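/- arXiv:2305.15838 — 2 statements merged into one kernel-verified Lean document; each statement's English description precedes it below -/
import Mathlib

section
/- Let m ≥ 3, E = ℝ^m, Cl the real Clifford algebra of Q(x) = -‖x‖². Define E_1(x) = (1/((m-2)σ_m)) ‖x‖^{2-m} for x ≠ 0 and E_0(x) = -(1/σ_m) ‖x‖^{-m} • ι(x), where σ_m is the surface area of the unit sphere in ℝ^m. Then the Dirac operator applied to the scalar (Cl-valued) function x ↦ E_1(x) • 1 recovers the Clifford–Cauchy kernel: for every x ≠ 0, ∑_{i=1}^m ι(e_i) · ∂_{x_i}( y ↦ E_1(y) • 1 )(x) = E_0(x). -/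
open MeasureTheory

/-- The derivative of the norm of a real inner product space away from the origin. -/
theorem hasFDerivAt_norm_of_ne_zero {F : Type*} [NormedAddCommGroup F] [InnerProductSpace ℝ F]
    {x : F} (hx : x ≠ 0) :
    HasFDerivAt (fun y : F => ‖y‖) (‖x‖⁻¹ • innerSL ℝ x) x := by
  have hsq : HasFDerivAt (fun y : F => ‖y‖ ^ 2) (2 • innerSL ℝ x) x :=
    (hasStrictFDerivAt_norm_sq x).hasFDerivAt
  have hsqrt := hsq.sqrt (pow_ne_zero 2 (norm_ne_zero_iff.mpr hx))
  simp only [Real.sqrt_sq (norm_nonneg _)] at hsqrt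
  convert hsqrt using 1
  ext v
  have := norm_ne_zero_iff.mpr hx
  simp
  field_simp

/-- The derivative of `y ↦ ‖y‖⁻ⁿ` away from the origin. -/
theorem hasFDerivAt_inv_norm_pow {F : Type*} [NormedAddCommGroup F] [InnerProductSpace ℝ F]
    (n : ℕ) {x : F} (hx : x ≠ 0) :
    HasFDerivAt (fun y : F => (‖y‖ ^ n)⁻¹)
      ((-(n * (‖x‖ ^ (n + 2))⁻¹)) • innerSL ℝ x) x := by
  have hx' := norm_ne_zero_iff.mpr hx
  have h := ((hasDerivAt_pow n ‖x‖).fun_inv (pow_ne_zero n hx')).comp_hasFDerivAt x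
    (hasFDerivAt_norm_of_ne_zero hx)
  refine h.congr_fderiv ?_
  rw [smul_smul]
  congr 1
  rcases n with _ | n
  · simp
  · simp only [Nat.add_sub_cancel]
    field_simp
    ring

/-- For `m ≥ 3`, applying the Dirac operator to the (Clifford‑valued) fundamental
solution of the Laplacian `E₁(x) = (1/((m-2)σ_m)) ‖x‖^{2-m}` recovers the
Clifford–Cauchy kernel `E₀(x) = -(1/σ_m) ‖x‖⁻ᵐ • ι(x)`:
`∑ i ι(eᵢ) · ∂_{x_i}(E₁ • 1)(x) = E₀(x)` for every `x ≠ 0`. -/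
theorem dirac_of_E1_eq_cliffordCauchyKernel
    (m : ℕ) (hm : 3 ≤ m)
    (Q : QuadraticForm ℝ (EuclideanSpace ℝ (Fin m)))
    (hQ : ∀ x : EuclideanSpace ℝ (Fin m), Q x = -‖x‖ ^ 2)
    {Cl : Type*} [NormedRing Cl] [NormedAlgebra ℝ Cl]
    (φ : CliffordAlgebra Q ≃ₐ[ℝ] Cl)
    (σm : ℝ)
    (hσm : σm = (μH[((m : ℝ) - 1)] (Metric.sphere (0 : EuclideanSpace ℝ (Fin m)) 1)).toReal)
    (E₁ : EuclideanSpace ℝ (Fin m) → ℝ)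
    (hE₁ : ∀ u : EuclideanSpace ℝ (Fin m),
      E₁ u = (((m : ℝ) - 2) * σm)⁻¹ * (‖u‖ ^ (m - 2))⁻¹)
    (E₀ : EuclideanSpace ℝ (Fin m) → Cl)
    (hE₀ : ∀ u : EuclideanSpace ℝ (Fin m),
      E₀ u = (-(σm⁻¹ * (‖u‖ ^ m)⁻¹)) • φ (CliffordAlgebra.ι Q u))
    (x : EuclideanSpace ℝ (Fin m)) (hx : x ≠ 0) :
    (∑ i : Fin m, φ (CliffordAlgebra.ι Q (EuclideanSpace.single i (1 : ℝ))) *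
        fderiv ℝ (fun y => E₁ y • (1 : Cl)) x (EuclideanSpace.single i (1 : ℝ)))
      = E₀ x := by
  obtain ⟨n, rfl⟩ : ∃ n, m = n + 2 := ⟨m - 2, by omega⟩
  have hn : (n : ℝ) ≠ 0 := Nat.cast_ne_zero.mpr (by omega)
  have hderiv : HasFDerivAt (fun y => E₁ y • (1 : Cl))
      (((((n : ℝ) * σm)⁻¹ • (-(n * (‖x‖ ^ (n + 2))⁻¹)) • innerSL ℝ x)).smulRight (1 : Cl)) x := by
    have hE : E₁ = fun u => ((n : ℝ) * σm)⁻¹ * (‖u‖ ^ n)⁻¹ := by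
      funext u
      rw [hE₁]
      simp
    rw [hE]
    exact ((hasFDerivAt_inv_norm_pow n hx).const_mul _).smul_const (1 : Cl)
  have hcoef : ((n : ℝ) * σm)⁻¹ * (-(n * (‖x‖ ^ (n + 2))⁻¹)) = -(σm⁻¹ * (‖x‖ ^ (n + 2))⁻¹) := by
    rw [mul_inv]
    field_simp
  have hsum : ∑ i, x i • φ (CliffordAlgebra.ι Q (EuclideanSpace.single i (1 : ℝ))) =
      φ (CliffordAlgebra.ι Q x) := by
    conv_rhs => rw [← (EuclideanSpace.basisFun (Fin (n + 2)) ℝ).sum_repr x]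
    simp [map_sum]
  rw [hderiv.fderiv, hE₀, ← hsum, Finset.smul_sum, smul_smul, hcoef]
  refine Finset.sum_congr rfl fun i _ => ?_
  simp [EuclideanSpace.inner_single_right, smul_smul]
end

section
/- Let m ≥ 2, E = ℝ^m, Cl the real Clifford algebra of Q(x) = -‖x‖², and σ = μH^{m-1} the (m-1)-dimensional Hausdorff measure. Let f : ℝ^m → Cl be continuous with a limit at infinity, f(y) → L as ‖y‖ → ∞ (convergence along the cocompact filter). Then for every fixed x ∈ ℝ^m, ∫_{y ∈ sphere(x,R)} E_0(y - x) · ι((1/R) • (y - x)) · f(y) dσ(y) → L as R → ∞, where E_0(u) = -(1/σ_m) ‖u‖^{-m} • ι(u) and σ_m is the surface area of the unit sphere in ℝ^m. -/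
open MeasureTheory Filter

/-- Outside the open unit ball, radial projection onto the unit sphere is `2`-Lipschitz. -/
theorem lipschitzOnWith_inv_norm_smul {E : Type*} [NormedAddCommGroup E] [NormedSpace ℝ E] :
    LipschitzOnWith 2 (fun v : E => ‖v‖⁻¹ • v) {v | 1 ≤ ‖v‖} := by
  refine LipschitzOnWith.of_dist_le_mul fun v hv w hw => ?_
  have hv' : 1 ≤ ‖v‖ := hv
  have hw' : 1 ≤ ‖w‖ := hw
  have hv0 : 0 < ‖v‖ := by linarith
  have hw0 : 0 < ‖w‖ := by linarith
  have hsplit : ‖v‖⁻¹ • v - ‖w‖⁻¹ • w = ‖v‖⁻¹ • (v - w) + (‖v‖⁻¹ * (‖w‖ - ‖v‖) * ‖w‖⁻¹) • w := by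
    have hcoeff : ‖v‖⁻¹ * (‖w‖ - ‖v‖) * ‖w‖⁻¹ = ‖v‖⁻¹ - ‖w‖⁻¹ := by field_simp
    rw [hcoeff]
    module
  have hinv : ‖v‖⁻¹ ≤ 1 := inv_le_one_of_one_le₀ hv'
  have habs : |‖w‖ - ‖v‖| ≤ ‖v - w‖ := by
    rw [norm_sub_rev]
    exact abs_norm_sub_norm_le w v
  rw [dist_eq_norm, dist_eq_norm, hsplit]
  calc ‖‖v‖⁻¹ • (v - w) + (‖v‖⁻¹ * (‖w‖ - ‖v‖) * ‖w‖⁻¹) • w‖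
      ≤ ‖‖v‖⁻¹ • (v - w)‖ + ‖(‖v‖⁻¹ * (‖w‖ - ‖v‖) * ‖w‖⁻¹) • w‖ := norm_add_le _ _
    _ = ‖v‖⁻¹ * ‖v - w‖ + ‖v‖⁻¹ * |‖w‖ - ‖v‖| := by
        simp only [norm_smul, norm_mul, norm_inv, Real.norm_eq_abs, abs_norm]
        field_simp
    _ ≤ 1 * ‖v - w‖ + 1 * ‖v - w‖ := by gcongr
    _ = ((2 : NNReal) : ℝ) * ‖v - w‖ := by push_cast; ring

theorem lipschitzWith_insertNth {n : ℕ} (i : Fin (n + 1)) (s : ℝ) :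
    LipschitzWith 1 (fun v : Fin n → ℝ => (i.insertNth s v : Fin (n + 1) → ℝ)) := by
  refine LipschitzWith.of_dist_le_mul fun v w => ?_
  rw [NNReal.coe_one, one_mul, dist_pi_le_iff dist_nonneg]
  refine i.forall_iff_succAbove.2 ⟨by simp, fun j => ?_⟩
  simpa using dist_le_pi_dist v w j

theorem hausdorffMeasure_unit_sphere_lt_top (n : ℕ) :
    μH[(n : ℝ)] (Metric.sphere (0 : EuclideanSpace ℝ (Fin (n + 1))) 1) < ⊤ := by
  let face (i : Fin (n + 1)) (s : ℝ) (v : Fin n → ℝ) : EuclideanSpace ℝ (Fin (n + 1)) :=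
    WithLp.toLp 2 (i.insertNth s v)
  have hcover : Metric.sphere (0 : EuclideanSpace ℝ (Fin (n + 1))) 1 ⊆
      ⋃ i : Fin (n + 1), ⋃ s ∈ ({1, -1} : Set ℝ),
        (fun v => ‖v‖⁻¹ • v) '' (face i s '' Metric.closedBall 0 1) := by
    intro y hy
    have hy1 : ‖y‖ = 1 := by simpa using hy
    obtain ⟨i, hi⟩ := Finite.exists_max fun j => |y j|
    have hyi : 0 < |y i| := by
      refine lt_of_le_of_ne (abs_nonneg _) fun h => ?_
      have hy0 : y = 0 := by
        ext j
        exact abs_nonpos_iff.1 ((hi j).trans h.ge)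
      simp [hy0] at hy1
    have hface : face i (|y i|⁻¹ * y i) (fun j => |y i|⁻¹ * y (i.succAbove j)) = |y i|⁻¹ • y := by
      ext j
      refine i.forall_iff_succAbove (P := fun j => face i _ _ j = (|y i|⁻¹ • y) j) |>.2
        ⟨by simp [face], fun k => by simp [face]⟩ j
    simp only [Set.mem_iUnion]
    refine ⟨i, |y i|⁻¹ * y i, ?_, _, ⟨_, ?_, hface⟩, ?_⟩
    · have hyi0 : y i ≠ 0 := abs_pos.1 hyi
      rcases abs_choice (y i) with h | h <;> rw [h] <;> simp [hyi0, inv_neg]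
    · rw [mem_closedBall_zero_iff, pi_norm_le_iff_of_nonneg zero_le_one]
      intro j
      rw [norm_mul, norm_inv, Real.norm_eq_abs, Real.norm_eq_abs, abs_abs]
      exact inv_mul_le_one_of_le₀ (hi _) hyi.le
    · simp only [norm_smul, norm_inv, Real.norm_eq_abs, abs_abs, hy1, mul_one, inv_inv, smul_smul]
      rw [mul_inv_cancel₀ hyi.ne', one_smul]
  refine (measure_mono hcover).trans_lt ?_
  refine (measure_iUnion_le _).trans_lt ?_
  rw [tsum_fintype]
  refine ENNReal.sum_lt_top.2 fun i _ => measure_biUnion_lt_top (by simp) fun s hs => ?_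
  have hmaps : face i s '' Metric.closedBall 0 1 ⊆ {v | 1 ≤ ‖v‖} := by
    rintro _ ⟨v, -, rfl⟩
    have hs1 : ‖s‖ = 1 := by rcases hs with rfl | rfl <;> simp
    simpa [face, hs1] using PiLp.norm_apply_le (face i s v) i
  have hface : LipschitzWith _ (face i s) :=
    (PiLp.lipschitzWith_toLp 2 (fun _ : Fin (n + 1) => ℝ)).comp (lipschitzWith_insertNth i s)
  refine ((lipschitzOnWith_inv_norm_smul.mono hmaps).hausdorffMeasure_image_le
    n.cast_nonneg).trans_lt ?_
  refine ENNReal.mul_lt_top (by simp) ?_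
  refine (hface.hausdorffMeasure_image_le n.cast_nonneg _).trans_lt ?_
  refine ENNReal.mul_lt_top (ENNReal.rpow_lt_top_of_nonneg n.cast_nonneg ENNReal.coe_ne_top) ?_
  have hvol : (μH[(n : ℝ)] : Measure (Fin n → ℝ)) = volume := by
    simpa using hausdorffMeasure_pi_real (ι := Fin n)
  rw [hvol]
  exact measure_closedBall_lt_top

theorem hausdorffMeasure_unit_sphere_pos (n : ℕ) :
    0 < μH[(n : ℝ)] (Metric.sphere (0 : EuclideanSpace ℝ (Fin (n + 1))) 1) := by
  let proj (y : EuclideanSpace ℝ (Fin (n + 1))) : Fin n → ℝ := fun j => y j.succ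
  have hproj : LipschitzWith 1 proj := by
    refine LipschitzWith.of_dist_le_mul fun y z => ?_
    rw [NNReal.coe_one, one_mul, dist_pi_le_iff dist_nonneg]
    exact fun j => PiLp.dist_apply_le y z j.succ
  have himage : {v : Fin n → ℝ | ∑ j, v j ^ 2 < 1} ⊆ proj '' Metric.sphere 0 1 := by
    intro v hv
    have hv' : ∑ j, v j ^ 2 < 1 := hv
    refine ⟨WithLp.toLp 2 (Fin.cons (√(1 - ∑ j, v j ^ 2)) v), ?_, by ext j; simp [proj]⟩
    rw [mem_sphere_zero_iff_norm, EuclideanSpace.norm_eq, Real.sqrt_eq_one, Fin.sum_univ_succ]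
    simp [Real.sq_sqrt (sub_nonneg.2 hv'.le)]
  have hopen : IsOpen {v : Fin n → ℝ | ∑ j, v j ^ 2 < 1} :=
    isOpen_lt (by fun_prop) continuous_const
  have hvol : (μH[(n : ℝ)] : Measure (Fin n → ℝ)) = volume := by
    simpa using hausdorffMeasure_pi_real (ι := Fin n)
  calc 0 < μH[(n : ℝ)] {v : Fin n → ℝ | ∑ j, v j ^ 2 < 1} := by
        rw [hvol]
        exact hopen.measure_pos _ ⟨0, by simp⟩
    _ ≤ μH[(n : ℝ)] (proj '' Metric.sphere 0 1) := measure_mono himage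
    _ ≤ _ := by simpa using hproj.hausdorffMeasure_image_le n.cast_nonneg (Metric.sphere 0 1)

open scoped Pointwise in
theorem hausdorffMeasure_sphere {E : Type*} [NormedAddCommGroup E] [NormedSpace ℝ E]
    [MeasurableSpace E] [BorelSpace E] (n : ℕ) (x : E) {R : ℝ} (hR : 0 < R) :
    μH[(n : ℝ)] (Metric.sphere x R) =
      ENNReal.ofReal (R ^ n) * μH[(n : ℝ)] (Metric.sphere (0 : E) 1) := by
  have hsphere : Metric.sphere x R = x +ᵥ R • Metric.sphere (0 : E) 1 := by
    rw [smul_sphere' hR.ne', Metric.vadd_sphere]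
    simp [abs_of_pos hR]
  rw [hsphere, measure_vadd, Measure.hausdorffMeasure_smul₀ n.cast_nonneg hR.ne',
    NNReal.rpow_natCast, ENNReal.smul_def, smul_eq_mul]
  congr 1
  rw [← Real.enorm_of_nonneg (by positivity), enorm_eq_nnnorm, nnnorm_pow]

/-- If `f` tends to `L` at infinity, so do its averages over large spheres of finite positive
measure. -/
theorem tendsto_setAverage_sphere {E F : Type*} [NormedAddCommGroup E] [ProperSpace E]
    [MeasurableSpace E] [BorelSpace E] [NormedAddCommGroup F] [NormedSpace ℝ F] [CompleteSpace F]
    {μ : Measure E} {f : E → F} {L : F} (hf : Continuous f)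
    (hL : Tendsto f (cocompact E) (nhds L)) (x : E)
    (hpos : ∀ᶠ R in atTop, μ (Metric.sphere x R) ≠ 0)
    (hfin : ∀ᶠ R in atTop, μ (Metric.sphere x R) ≠ ⊤) :
    Tendsto (fun R : ℝ => ⨍ y in Metric.sphere x R, f y ∂μ) atTop (nhds L) := by
  refine Metric.nhds_basis_closedBall.tendsto_right_iff.2 fun ε hε => ?_
  have hnear : ∀ᶠ y in comap (dist · x) atTop, f y ∈ Metric.closedBall L ε := by
    rw [Metric.comap_dist_right_atTop, Metric.cobounded_eq_cocompact]
    exact hL (Metric.closedBall_mem_nhds L hε)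
  filter_upwards [eventually_comap.1 hnear, hpos, hfin] with R hRnear hRpos hRfin
  have hmem : ∀ᵐ y ∂μ.restrict (Metric.sphere x R), f y ∈ Metric.closedBall L ε :=
    ae_restrict_of_forall_mem Metric.isClosed_sphere.measurableSet fun y hy => hRnear y hy
  refine (convex_closedBall L ε).set_average_mem Metric.isClosed_closedBall hRpos hRfin hmem ?_
  have hbound : ∀ᵐ y ∂μ.restrict (Metric.sphere x R), ‖f y‖ ≤ ‖L‖ + ε := by
    filter_upwards [hmem] with y hy
    exact norm_le_of_mem_closedBall hy
  exact Measure.integrableOn_of_bounded hRfin hf.aestronglyMeasurable hbound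

theorem CliffordAlgebra.algEquiv_ι_mul_ι_smul {E : Type*} [NormedAddCommGroup E] [NormedSpace ℝ E]
    {Q : QuadraticForm ℝ E} (hQ : ∀ x, Q x = -‖x‖ ^ 2) {A : Type*} [Ring A] [Algebra ℝ A]
    (φ : CliffordAlgebra Q ≃ₐ[ℝ] A) (r : ℝ) (u : E) :
    φ (CliffordAlgebra.ι Q u) * φ (CliffordAlgebra.ι Q (r • u)) = (-(r * ‖u‖ ^ 2)) • 1 := by
  rw [← map_mul, map_smul, mul_smul_comm, CliffordAlgebra.ι_sq_scalar, hQ, map_smul,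
    AlgEquiv.commutes, Algebra.algebraMap_eq_smul_one, smul_smul, mul_neg]

/-- If `f : ℝ^m → Cl` is continuous and tends to `L` at infinity (along the cocompact
filter), then for every fixed `x` the Cauchy-kernel sphere averages
`∫_{y ∈ sphere(x,R)} E₀(y-x) · ι((1/R) • (y-x)) · f(y) dσ(y)` converge to `L`
as `R → ∞`, where `E₀(u) = -(1/σ_m) ‖u‖⁻ᵐ • ι(u)` and `σ = μH^{m-1}`. -/
theorem tendsto_sphere_average_cliffordCauchyKernel
    (m : ℕ) (hm : 2 ≤ m)
    (Q : QuadraticForm ℝ (EuclideanSpace ℝ (Fin m)))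
    (hQ : ∀ x : EuclideanSpace ℝ (Fin m), Q x = -‖x‖ ^ 2)
    {Cl : Type*} [NormedRing Cl] [NormedAlgebra ℝ Cl] [CompleteSpace Cl]
    (φ : CliffordAlgebra Q ≃ₐ[ℝ] Cl)
    (σm : ℝ)
    (hσm : σm = (μH[((m : ℝ) - 1)] (Metric.sphere (0 : EuclideanSpace ℝ (Fin m)) 1)).toReal)
    (E₀ : EuclideanSpace ℝ (Fin m) → Cl)
    (hE₀ : ∀ u : EuclideanSpace ℝ (Fin m),
      E₀ u = (-(σm⁻¹ * (‖u‖ ^ m)⁻¹)) • φ (CliffordAlgebra.ι Q u))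
    (f : EuclideanSpace ℝ (Fin m) → Cl) (L : Cl)
    (hf : Continuous f)
    (hL : Tendsto f (cocompact (EuclideanSpace ℝ (Fin m))) (nhds L))
    (x : EuclideanSpace ℝ (Fin m)) :
    Tendsto
      (fun R : ℝ =>
        ∫ y in Metric.sphere x R,
          E₀ (y - x) * φ (CliffordAlgebra.ι Q (R⁻¹ • (y - x))) * f y
        ∂(μH[((m : ℝ) - 1)]))
      atTop (nhds L) := by
  obtain ⟨n, rfl⟩ : ∃ n, m = n + 1 := ⟨m - 1, by omega⟩
  have hdim : ((n + 1 : ℕ) : ℝ) - 1 = n := by push_cast; ring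
  rw [hdim] at hσm ⊢
  have htop := (hausdorffMeasure_unit_sphere_lt_top n).ne
  have hzero := (hausdorffMeasure_unit_sphere_pos n).ne'
  refine (tendsto_setAverage_sphere (μ := μH[(n : ℝ)]) hf hL x ?_ ?_).congr' ?_
  · filter_upwards [eventually_gt_atTop 0] with R hR
    rw [hausdorffMeasure_sphere n x hR]
    exact mul_ne_zero (by simpa using pow_pos hR n) hzero
  · filter_upwards [eventually_gt_atTop 0] with R hR
    rw [hausdorffMeasure_sphere n x hR]
    exact ENNReal.mul_ne_top ENNReal.ofReal_ne_top htop
  filter_upwards [eventually_gt_atTop 0] with R hR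
  have hmeas : (μH[(n : ℝ)]).real (Metric.sphere x R) = R ^ n * σm := by
    rw [measureReal_def, hausdorffMeasure_sphere n x hR, ENNReal.toReal_mul,
      ENNReal.toReal_ofReal (by positivity), hσm]
  rw [setAverage_eq, hmeas, ← integral_smul]
  refine setIntegral_congr_fun Metric.isClosed_sphere.measurableSet fun y hy => ?_
  have hnorm : ‖y - x‖ = R := by rwa [mem_sphere_iff_norm] at hy
  simp only [hE₀, smul_mul_assoc, CliffordAlgebra.algEquiv_ι_mul_ι_smul hQ, smul_smul, one_mul,
    hnorm]
  congr 1
  rw [mul_inv, pow_succ]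
  field_simp
end
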